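/- Let n ≥ 2, k ≥ 2 and fix device counts m_j > 0. There is no allocation mechanism S assigning to every positive speedup matrix W a feasible allocation S(W) such that both: (i) for every W, S(W) is envy-free with respect to W and attains the maximum total efficiency (with respect to W) among all feasible envy-free allocations; and (ii) S is strategy-proof, i.e. for every W, every user l, and every speedup matrix W' that agrees with W outside row l and satisfies W'_l ≥ W_l componentwise, user l's true throughput does not increase: W_l · S(W')_l ≤ W_l · S(W)_l. -/

import Mathlib

open Finset

/-- `dotRow w x = ∑ j, w j * x j`: throughput a user with speedup row `w`
obtains from the allocation row `x`. -/
def dotRow {k : ℕ} (w x : Fin k → ℝ) : ℝ := ∑ j, w j * x j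

/-- User `l`'s throughput under allocation `X` given speedup matrix `W`. -/
def throughput {n k : ℕ} (W X : Fin n → Fin k → ℝ) (l : Fin n) : ℝ := dotRow (W l) (X l)

/-- Total efficiency of allocation `X` under speedup matrix `W`. -/
def totalEff {n k : ℕ} (W X : Fin n → Fin k → ℝ) : ℝ := ∑ l, throughput W X l

/-- `X` is a feasible allocation: entrywise nonnegative and, for each GPU type `j`,
at most `m j` devices are allocated. -/
def Feasible {n k : ℕ} (m : Fin k → ℝ) (X : Fin n → Fin k → ℝ) : Prop :=
  (∀ l j, 0 ≤ X l j) ∧ ∀ j, ∑ l, X l j ≤ m j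

/-- `X` is envy-free w.r.t. `W`: no user prefers another user's allocation row. -/
def EnvyFree {n k : ℕ} (W X : Fin n → Fin k → ℝ) : Prop :=
  ∀ l i, dotRow (W l) (X i) ≤ dotRow (W l) (X l)

/-- `X` is sharing-incentive w.r.t. `W` and device counts `m`: every user gets at
least the throughput of a `1/n` share of every device type. -/
def SharingIncentive {n k : ℕ} (m : Fin k → ℝ) (W X : Fin n → Fin k → ℝ) : Prop :=
  ∀ l, (1 / (n : ℝ)) * ∑ j, m j * W l j ≤ throughput W X l

/-- The profile in which user `0` has speedup row `w` and all other users have row `v`. -/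
def twoRowProfile {N k : ℕ} (w v : Fin k → ℝ) : Fin (N + 1) → Fin k → ℝ :=
  Fin.cons w fun _ => v

/-- The speedup row valuing the whole stock of type `0` at `c` and of every other type at `d`. -/
noncomputable def stockValueRow {K : ℕ} (m : Fin (K + 1) → ℝ) (c d : ℝ) : Fin (K + 1) → ℝ :=
  Fin.cons (c / m 0) fun j => d / m j.succ

/-- The bundle made of a fraction `a` of type `0` and a fraction `b` of every other type. -/
noncomputable def stockBundle {K : ℕ} (m : Fin (K + 1) → ℝ) (a b : ℝ) : Fin (K + 1) → ℝ :=
  Fin.cons (a * m 0) fun j => b * m j.succ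

/-- User `0` receives a fraction `x` of type `0`; the other users share the rest equally. -/
noncomputable def splitAllocation {N K : ℕ} (m : Fin (K + 1) → ℝ) (x : ℝ) :
    Fin (N + 2) → Fin (K + 1) → ℝ :=
  twoRowProfile (stockBundle m x 0) (stockBundle m ((1 - x) / (N + 1)) (1 / (N + 1)))

lemma dotRow_stockValueRow_stockBundle {K : ℕ} {m : Fin (K + 1) → ℝ} (hm : ∀ j, 0 < m j)
    (c d a b : ℝ) :
    dotRow (stockValueRow m c d) (stockBundle m a b) = c * a + K * (d * b) := by
  have h0 := (hm 0).ne'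
  have h : ∀ j : Fin K, d / m j.succ * (b * m j.succ) = d * b := fun j => by
    have := (hm j.succ).ne'
    field_simp
  simp only [dotRow, stockValueRow, stockBundle, Fin.sum_univ_succ, Fin.cons_zero,
    Fin.cons_succ, h, sum_const, card_univ, Fintype.card_fin, nsmul_eq_mul]
  field_simp

lemma dotRow_stockValueRow_self {K : ℕ} {m : Fin (K + 1) → ℝ} (hm : ∀ j, 0 < m j)
    (c d : ℝ) : dotRow (stockValueRow m c d) m = c + K * d := by
  have h : stockBundle m 1 1 = m := by
    funext j
    cases j using Fin.cases <;> simp [stockBundle]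
  simpa [h] using dotRow_stockValueRow_stockBundle hm c d 1 1

lemma stockValueRow_pos {K : ℕ} {m : Fin (K + 1) → ℝ} (hm : ∀ j, 0 < m j) {c d : ℝ}
    (hc : 0 < c) (hd : 0 < d) (j : Fin (K + 1)) : 0 < stockValueRow m c d j := by
  cases j using Fin.cases with
  | zero => exact div_pos hc (hm 0)
  | succ j => exact div_pos hd (hm j.succ)

lemma stockValueRow_mono {K : ℕ} {m : Fin (K + 1) → ℝ} (hm : ∀ j, 0 < m j) {c c' d d' : ℝ}
    (hc : c ≤ c') (hd : d ≤ d') (j : Fin (K + 1)) :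
    stockValueRow m c d j ≤ stockValueRow m c' d' j := by
  cases j using Fin.cases with
  | zero => exact div_le_div_of_nonneg_right hc (hm 0).le
  | succ j => exact div_le_div_of_nonneg_right hd (hm j.succ).le

lemma dotRow_mono_left {k : ℕ} {w v x : Fin k → ℝ} (hx : ∀ j, 0 ≤ x j)
    (h : ∀ j, w j ≤ v j) : dotRow w x ≤ dotRow v x :=
  sum_le_sum fun j _ => mul_le_mul_of_nonneg_right (h j) (hx j)

lemma dotRow_stockValueRow_eq {K : ℕ} (m x : Fin (K + 1) → ℝ) (c d : ℝ) :
    dotRow (stockValueRow m c d) x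
      = c * (x 0 / m 0) + d * ∑ j : Fin K, x j.succ / m j.succ := by
  simp only [dotRow, stockValueRow, Fin.sum_univ_succ, Fin.cons_zero, Fin.cons_succ, mul_sum]
  congr 1
  · ring
  · exact sum_congr rfl fun j _ => by ring

/-- Whatever user `0` does not receive is worth at most its `v`-value to the other users. -/
lemma totalEff_twoRowProfile_le {N k : ℕ} {m w v : Fin k → ℝ} (hv : ∀ j, 0 ≤ v j)
    {Y : Fin (N + 1) → Fin k → ℝ} (hY : Feasible m Y) :
    totalEff (twoRowProfile w v) Y ≤ dotRow v m + dotRow w (Y 0) - dotRow v (Y 0) := by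
  have h : ∑ l : Fin N, dotRow v (Y l.succ) ≤ dotRow v m - dotRow v (Y 0) := by
    simp only [dotRow]
    rw [sum_comm, ← sum_sub_distrib]
    refine sum_le_sum fun j _ => ?_
    rw [← mul_sum, ← mul_sub]
    have := hY.2 j
    rw [Fin.sum_univ_succ] at this
    exact mul_le_mul_of_nonneg_left (by linarith) (hv j)
  simp only [totalEff, throughput, twoRowProfile, Fin.sum_univ_succ, Fin.cons_zero,
    Fin.cons_succ]
  linarith

lemma splitAllocation_feasible {N K : ℕ} {m : Fin (K + 1) → ℝ} (hm : ∀ j, 0 < m j)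
    {x : ℝ} (hx0 : 0 ≤ x) (hx1 : x ≤ 1) :
    Feasible m (splitAllocation (N := N) m x) := by
  have hN : (0 : ℝ) < N + 1 := by positivity
  have h1x : 0 ≤ 1 - x := by linarith
  refine ⟨fun l j => ?_, fun j => ?_⟩
  · have h0 := (hm 0).le
    have hj : ∀ j : Fin K, 0 ≤ m j.succ := fun j => (hm j.succ).le
    cases l using Fin.cases <;> cases j using Fin.cases <;>
      simp only [splitAllocation, twoRowProfile, stockBundle, Fin.cons_zero, Fin.cons_succ,
        zero_mul, le_refl]
    · positivity
    · positivity
    · exact mul_nonneg (by positivity) (hj _)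
  · rw [Fin.sum_univ_succ]
    cases j using Fin.cases <;>
      simp only [splitAllocation, twoRowProfile, stockBundle, Fin.cons_zero, Fin.cons_succ,
        sum_const, card_univ, Fintype.card_fin, nsmul_eq_mul, Nat.cast_add, Nat.cast_one] <;>
      apply le_of_eq <;> field_simp <;> ring

lemma splitAllocation_envyFree {N K : ℕ} {m : Fin (K + 1) → ℝ} (hm : ∀ j, 0 < m j)
    {x c d a b : ℝ} (hw : c * (1 - x) + K * d ≤ (N + 1) * (c * x))
    (hv : (N + 1) * (a * x) ≤ a * (1 - x) + K * b) :
    EnvyFree (twoRowProfile (stockValueRow m c d) (stockValueRow m a b))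
      (splitAllocation (N := N) m x) := by
  have hN : (0 : ℝ) < N + 1 := by positivity
  intro l i
  cases l using Fin.cases <;> cases i using Fin.cases <;>
    simp only [splitAllocation, twoRowProfile, Fin.cons_zero, Fin.cons_succ,
      dotRow_stockValueRow_stockBundle hm, le_refl]
  · rw [show c * ((1 - x) / (N + 1)) + K * (d * (1 / (N + 1)))
      = (c * (1 - x) + K * d) / ((N : ℝ) + 1) by ring, div_le_iff₀ hN]
    linarith
  · rw [show a * ((1 - x) / (N + 1)) + K * (b * (1 / (N + 1)))
      = (a * (1 - x) + K * b) / ((N : ℝ) + 1) by ring, le_div_iff₀ hN]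
    linarith

lemma totalEff_splitAllocation {N K : ℕ} {m : Fin (K + 1) → ℝ} (hm : ∀ j, 0 < m j)
    (x c d a b : ℝ) :
    totalEff (twoRowProfile (stockValueRow m c d) (stockValueRow m a b))
      (splitAllocation (N := N) m x) = c * x + a * (1 - x) + K * b := by
  have hN : (N : ℝ) + 1 ≠ 0 := by positivity
  simp only [totalEff, throughput, splitAllocation, twoRowProfile, Fin.sum_univ_succ,
    Fin.cons_zero, Fin.cons_succ, dotRow_stockValueRow_stockBundle hm, sum_const, card_univ,
    Fintype.card_fin, nsmul_eq_mul, Nat.cast_add, Nat.cast_one, mul_zero, add_zero]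
  field_simp
  ring

/-- No mechanism assigning to every positive speedup matrix a feasible envy-free
allocation of maximum total efficiency (among feasible envy-free allocations)
can be strategy-proof. -/
theorem no_efficient_envyFree_strategyProof_mechanism {n k : ℕ}
    (hn : 2 ≤ n) (hk : 2 ≤ k) (m : Fin k → ℝ) (hm : ∀ j, 0 < m j) :
    ¬ ∃ S : (Fin n → Fin k → ℝ) → (Fin n → Fin k → ℝ),
      (∀ W : Fin n → Fin k → ℝ, (∀ l j, 0 < W l j) →
        Feasible m (S W) ∧ EnvyFree W (S W) ∧
          ∀ X : Fin n → Fin k → ℝ, Feasible m X → EnvyFree W X →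
            totalEff W X ≤ totalEff W (S W)) ∧
      (∀ W : Fin n → Fin k → ℝ, (∀ l j, 0 < W l j) →
        ∀ (l : Fin n) (W' : Fin n → Fin k → ℝ), (∀ i j, 0 < W' i j) →
          (∀ i, i ≠ l → W' i = W i) → (∀ j, W l j ≤ W' l j) →
          dotRow (W l) (S W' l) ≤ dotRow (W l) (S W l)) := by
  rintro ⟨S, hS, hSP⟩
  obtain ⟨N, rfl⟩ := Nat.exists_eq_add_of_le' hn
  obtain ⟨K, rfl⟩ := Nat.exists_eq_add_of_le' hk
  have hN : (0 : ℝ) ≤ N := N.cast_nonneg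
  have hK : (0 : ℝ) ≤ K := K.cast_nonneg
  set κ : ℝ := K + 2 with hκ
  have hκ0 : 0 < κ := by positivity
  set b : ℝ := 2 * κ * (N + 2) with hb
  have hb2 : 2 * κ ≤ b := by rw [hb]; nlinarith
  have hKb : (N + 2) * (2 * κ) ≤ (K + 1) * b := by
    rw [hb]; nlinarith [mul_nonneg hK (mul_nonneg hκ0.le (by positivity : (0 : ℝ) ≤ N + 2))]
  set v := stockValueRow m (2 * κ) b with hv
  set w := stockValueRow m κ 1 with hw
  set w' := stockValueRow m (3 * κ) 1 with hw'
  have hv0 : ∀ j, 0 < v j := stockValueRow_pos hm (by linarith) (by linarith)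
  have hw0 : ∀ j, 0 < w j := stockValueRow_pos hm hκ0 one_pos
  have hw'0 : ∀ j, 0 < w' j := stockValueRow_pos hm (by linarith) one_pos
  have hpos : ∀ u : Fin (K + 2) → ℝ, (∀ j, 0 < u j) →
      ∀ (l : Fin (N + 2)) j, 0 < twoRowProfile u v l j := fun u hu l j => by
    cases l using Fin.cases
    · exact hu j
    · exact hv0 j
  have hcast : ((K + 1 : ℕ) : ℝ) = K + 1 := by push_cast; rfl
  obtain ⟨hF, -, hopt⟩ := hS (twoRowProfile w v) (hpos w hw0)
  obtain ⟨hF', -, hopt'⟩ := hS (twoRowProfile w' v) (hpos w' hw'0)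
  have hsp := hSP (twoRowProfile w v) (hpos w hw0) 0 (twoRowProfile w' v) (hpos w' hw'0)
    (fun i hi => by
      obtain ⟨i, rfl⟩ := Fin.exists_succ_eq.2 hi
      rfl)
    (stockValueRow_mono hm (by linarith) le_rfl)
  set Y := S (twoRowProfile w v)
  set Y' := S (twoRowProfile w' v)
  change dotRow w (Y' 0) ≤ dotRow w (Y 0) at hsp
  have hVm : dotRow v m = 2 * κ + (K + 1) * b := by
    rw [hv, dotRow_stockValueRow_self hm, hcast]
  -- Overreporting gives user `0` the entire stock of type `0`.
  have hY'0 : 1 ≤ Y' 0 0 / m 0 := by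
    have hle := hopt' (splitAllocation m 1) (splitAllocation_feasible hm zero_le_one le_rfl)
      (splitAllocation_envyFree hm (by rw [hcast]; nlinarith) (by rw [hcast]; nlinarith))
    rw [totalEff_splitAllocation hm, hcast] at hle
    have hub := totalEff_twoRowProfile_le (w := w') (fun j => (hv0 j).le) hF'
    have hs : 0 ≤ ∑ j : Fin (K + 1), Y' 0 j.succ / m j.succ :=
      sum_nonneg fun j _ => div_nonneg (hF'.1 0 _) (hm _).le
    rw [hVm, hv, hw', dotRow_stockValueRow_eq, dotRow_stockValueRow_eq] at hub
    have hmul : 1 * ∑ j : Fin (K + 1), Y' 0 j.succ / m j.succ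
        ≤ b * ∑ j : Fin (K + 1), Y' 0 j.succ / m j.succ :=
      mul_le_mul_of_nonneg_right (by linarith) hs
    refine le_of_mul_le_mul_left ?_ hκ0
    linarith
  have hlow : κ ≤ dotRow w (Y' 0) := by
    have hs : 0 ≤ ∑ j : Fin (K + 1), Y' 0 j.succ / m j.succ :=
      sum_nonneg fun j _ => div_nonneg (hF'.1 0 _) (hm _).le
    rw [hw, dotRow_stockValueRow_eq]
    nlinarith
  -- Truthful reporting gives user `0` strictly less than the value of that stock.
  have hup : dotRow w (Y 0) ≤ κ - 1 / 2 := by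
    have hx : κ * (1 - 1 / (2 * κ)) = κ - 1 / 2 := by field_simp
    have hx1 : 1 - 1 / (2 * κ) ≤ 1 := by
      have : 0 < 1 / (2 * κ) := by positivity
      linarith
    have hx0 : 0 ≤ 1 - 1 / (2 * κ) := by
      rw [sub_nonneg, div_le_one (by positivity)]
      linarith
    set x := 1 - 1 / (2 * κ)
    have hle := hopt (splitAllocation m x) (splitAllocation_feasible hm hx0 hx1)
      (splitAllocation_envyFree hm (by rw [hcast]; nlinarith) (by rw [hcast]; nlinarith))
    rw [totalEff_splitAllocation hm, hcast] at hle
    have hub := totalEff_twoRowProfile_le (w := w) (fun j => (hv0 j).le) hF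
    have h2 : 2 * dotRow w (Y 0) ≤ dotRow v (Y 0) := by
      have hmono := dotRow_mono_left (hF.1 0)
        (stockValueRow_mono hm le_rfl (by linarith : (2 : ℝ) ≤ b) (c := 2 * κ))
      rw [dotRow_stockValueRow_eq] at hmono
      rw [hw, dotRow_stockValueRow_eq]
      linarith
    linarith
  linarith
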